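/- For every m ≥ 0 and all 1 ≤ j, k ≤ n, the (j,k)-entry of the matrix product A^{(m)}(x) = A(x) A(q^{−1}x) ⋯ A(q^{−m}x) equals (−1)^{k−1} t^{(m+1−j)}_k(q^{1−j}x), as an identity of rational functions in x. -/

import Mathlib

open Polynomial

noncomputable section

/-- The rational function `x ↦ f (c * x)`. -/
def qshift (c : ℂ) (f : RatFunc ℂ) : RatFunc ℂ :=
  algebraMap (Polynomial ℂ) (RatFunc ℂ) (f.num.comp (C c * X)) /
    algebraMap (Polynomial ℂ) (RatFunc ℂ) (f.denom.comp (C c * X))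

/-- `t_k = a_k / a_0`, with the convention `t_k = 0` for `k < 0` or `k > n`. -/
def tcoef (n : ℕ) (a : ℕ → Polynomial ℂ) (k : ℤ) : RatFunc ℂ :=
  if 0 ≤ k ∧ k ≤ (n : ℤ) then
    algebraMap (Polynomial ℂ) (RatFunc ℂ) (a k.toNat) /
      algebraMap (Polynomial ℂ) (RatFunc ℂ) (a 0)
  else 0

/-- The `(m+1) × (m+1)` determinant defining `t^{(m)}_k` for `m ≥ 1`. -/
def tdet (q : ℂ) (t : ℤ → RatFunc ℂ) (m : ℕ) (k : ℤ) : RatFunc ℂ :=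
  Matrix.det (Matrix.of fun i j : Fin (m + 1) =>
    if (j : ℕ) < m then qshift (q ^ (-((i : ℕ) : ℤ))) (t (((j : ℕ) : ℤ) - ((i : ℕ) : ℤ) + 1))
    else qshift (q ^ (-((i : ℕ) : ℤ))) (t (k + (m : ℤ) - ((i : ℕ) : ℤ))))

/-- `t^{(m)}_k`, with `t^{(0)}_k = t_k` and `t^{(m)}_k = (-1)^{k-1} δ_{k+m,0}` for `m < 0`. -/
def tmk (q : ℂ) (t : ℤ → RatFunc ℂ) (m : ℤ) (k : ℤ) : RatFunc ℂ :=
  if m < 0 then (if k + m = 0 then (-1 : RatFunc ℂ) ^ (k - 1) else 0)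
  else if m = 0 then t k
  else tdet q t m.toNat k

/-- The `n × n` companion matrix `A(x)` of the scalar operator: first row
`(t_1(x), -t_2(x), …, (-1)^{n-1} t_n(x))`, subdiagonal entries `1`, zeros elsewhere. -/
def companion (n : ℕ) (t : ℤ → RatFunc ℂ) : Matrix (Fin n) (Fin n) (RatFunc ℂ) :=
  Matrix.of fun i j =>
    if (i : ℕ) = 0 then (-1 : RatFunc ℂ) ^ (j : ℕ) * t (((j : ℕ) : ℤ) + 1)
    else if (i : ℕ) = (j : ℕ) + 1 then 1 else 0

/-- `A^{(m)}(x) = A(x) A(q^{-1} x) ⋯ A(q^{-m} x)`. -/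
def Aprod (q : ℂ) (n : ℕ) (t : ℤ → RatFunc ℂ) (m : ℕ) :
    Matrix (Fin n) (Fin n) (RatFunc ℂ) :=
  ((List.range (m + 1)).map fun j => (companion n t).map (qshift (q ^ (-(j : ℤ))))).prod

/-- The endomorphism `f ↦ f (c * x)` of the field of rational functions. -/
def qshiftHom (c : ℂ) (hc : c ≠ 0) : RatFunc ℂ →+* RatFunc ℂ :=
  RatFunc.mapRingHom (compRingHom (C c * X)) fun p hp => by
    rw [mem_nonZeroDivisors_iff_ne_zero] at hp
    rw [Submonoid.mem_comap, mem_nonZeroDivisors_iff_ne_zero, coe_compRingHom_apply]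
    exact fun h => hp ((comp_C_mul_X_eq_zero_iff (mem_nonZeroDivisors_of_ne_zero hc)).1 h)

theorem qshiftHom_apply (c : ℂ) (hc : c ≠ 0) (f : RatFunc ℂ) :
    qshiftHom c hc f = qshift c f := by
  simp [qshiftHom, qshift, RatFunc.coe_mapRingHom_eq_coe_map, RatFunc.map_apply]

theorem qshiftHom_algebraMap (c : ℂ) (hc : c ≠ 0) (p : Polynomial ℂ) :
    qshiftHom c hc (algebraMap _ _ p) = algebraMap _ _ (p.comp (C c * X)) := by
  simp [qshiftHom_apply, qshift]

theorem qshift_one (f : RatFunc ℂ) : qshift 1 f = f := by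
  simp [qshift, RatFunc.num_div_denom]

theorem qshift_mul (c d : ℂ) (hc : c ≠ 0) (f : RatFunc ℂ) :
    qshift (c * d) f = qshift c (qshift d f) := by
  rw [← qshiftHom_apply c hc, qshift, qshift, map_div₀, qshiftHom_algebraMap,
    qshiftHom_algebraMap, comp_assoc, comp_assoc]
  simp only [mul_comp, C_comp, X_comp, C_mul]
  rw [mul_left_comm, mul_assoc]

theorem qshiftHom_pow_apply (q : ℂ) (hq : q⁻¹ ≠ 0) (i : ℕ) (f : RatFunc ℂ) :
    (qshiftHom q⁻¹ hq ^ i) f = qshift (q ^ (-(i : ℤ))) f := by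
  induction i with
  | zero => simp [qshift_one]
  | succ i ih =>
    have h : q ^ (-((i + 1 : ℕ) : ℤ)) = q⁻¹ * q ^ (-(i : ℤ)) := by
      rw [zpow_neg, zpow_neg, zpow_natCast, zpow_natCast, pow_succ', mul_inv]
    rw [h, qshift_mul _ _ hq, pow_succ', RingHom.mul_def, RingHom.comp_apply, ih,
      qshiftHom_apply]

section Hessenberg

variable {R : Type*} [CommRing R] (σ : R →+* R) (t : ℤ → R) (k : ℤ)

/-- The index of `t` in the first row and column `j` of the matrix defining `t^{(m)}_k`. -/
def colIndex (m j : ℕ) : ℤ := if j < m then (j : ℤ) + 1 else k + m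

/-- The matrix defining `t^{(m)}_k`, with `σ ^ s` applied to its entries. -/
def hessMatrix (m s : ℕ) : Matrix (Fin (m + 1)) (Fin (m + 1)) R :=
  Matrix.of fun i j => (σ ^ (s + (i : ℕ))) (t (colIndex k m j - ((i : ℕ) : ℤ)))

theorem colIndex_succ (m j : ℕ) : colIndex k (m + 1) (j + 1) = colIndex k m j + 1 := by
  unfold colIndex
  split_ifs <;> omega

/-- Expansion along the first row of the matrix defining `t^{(m)}_k` with its first row replaced
by `v`. -/
theorem det_hessMatrix_updateRow (ht0 : t 0 = 1) (ht : ∀ i < 0, t i = 0) (m : ℕ) :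
    ∀ (s : ℕ) (v : ℕ → R),
      ((hessMatrix σ t k m s).updateRow 0 fun j => v j).det =
        ∑ j ∈ Finset.range m,
            (-1) ^ j * v j * (hessMatrix σ t k (m - 1 - j) (s + (j + 1))).det +
          (-1) ^ m * v m := by
  induction m with
  | zero => intro s v; simp
  | succ m ih =>
    intro s v
    have hcol : ∀ i : Fin m,
        (hessMatrix σ t k (m + 1) s) i.succ.succ 0 = 0 := by
      intro i
      have : t (colIndex k (m + 1) 0 - ((i : ℕ) + 1 + 1 : ℤ)) = 0 :=
        ht _ (by simp [colIndex]; omega)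
      simp [hessMatrix, this]
    have hone : (hessMatrix σ t k (m + 1) s) (Fin.succ 0) 0 = 1 := by
      simp [hessMatrix, colIndex, ht0]
    have hminor0 : ((hessMatrix σ t k (m + 1) s).updateRow 0 fun j => v j).submatrix
        (Fin.succAbove 0) Fin.succ = hessMatrix σ t k m (s + 1) := by
      ext i j
      simp only [Matrix.submatrix_apply, Fin.succAbove_zero,
        Matrix.updateRow_ne (Fin.succ_ne_zero i), hessMatrix, Matrix.of_apply, Fin.val_succ,
        colIndex_succ]
      congr 2 <;> omega
    have hminor1 : ((hessMatrix σ t k (m + 1) s).updateRow 0 fun j => v j).submatrix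
        (Fin.succAbove (Fin.succ 0)) Fin.succ =
          (hessMatrix σ t k m (s + 1)).updateRow 0 fun j => v (j + 1) := by
      ext i j
      refine Fin.cases ?_ (fun i => ?_) i
      · simp
      · simp only [Matrix.submatrix_apply, Fin.succ_succAbove_succ, Fin.succAbove_zero,
          Matrix.updateRow_ne (Fin.succ_ne_zero _), hessMatrix, Matrix.of_apply, Fin.val_succ,
          colIndex_succ]
        congr 2 <;> omega
    rw [Matrix.det_succ_column_zero, Fin.sum_univ_succ, Fin.sum_univ_succ, hminor0, hminor1,
      ih (s + 1) (fun j => v (j + 1)), Finset.sum_range_succ']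
    simp only [Matrix.updateRow_ne (Fin.succ_ne_zero _), Matrix.updateRow_self, hcol, hone]
    have hterm : ∀ j ∈ Finset.range m,
        (-1) ^ (j + 1) * v (j + 1) *
            (hessMatrix σ t k (m + 1 - 1 - (j + 1)) (s + (j + 1 + 1))).det =
          -((-1) ^ j * v (j + 1) * (hessMatrix σ t k (m - 1 - j) (s + 1 + (j + 1))).det) := by
      intro j _
      rw [show m + 1 - 1 - (j + 1) = m - 1 - j by omega,
        show s + (j + 1 + 1) = s + 1 + (j + 1) by omega]
      ring
    rw [Finset.sum_congr rfl hterm, Finset.sum_neg_distrib]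
    simp
    ring

theorem det_hessMatrix (ht0 : t 0 = 1) (ht : ∀ i < 0, t i = 0) (m : ℕ) :
    (hessMatrix σ t k m 0).det =
      ∑ j ∈ Finset.range m,
          (-1) ^ j * t (j + 1) * (hessMatrix σ t k (m - 1 - j) (j + 1)).det +
        (-1) ^ m * t (k + m) := by
  have h := det_hessMatrix_updateRow σ t k ht0 ht m 0 fun j => t (colIndex k m j)
  have hrow : ((hessMatrix σ t k m 0).updateRow 0 fun j => t (colIndex k m j)) =
      hessMatrix σ t k m 0 := by
    conv_rhs => rw [← Matrix.updateRow_eq_self (hessMatrix σ t k m 0) 0]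
    congr 1
    ext j
    simp [hessMatrix]
  rw [hrow] at h
  rw [h]
  congr 1
  · refine Finset.sum_congr rfl fun j hj => ?_
    rw [zero_add, colIndex, if_pos (Finset.mem_range.1 hj)]
  · simp [colIndex]

theorem pow_apply_det_hessMatrix (m s : ℕ) :
    (σ ^ s) (hessMatrix σ t k m 0).det = (hessMatrix σ t k m s).det := by
  rw [RingHom.map_det]
  congr 1
  ext i j
  simp [hessMatrix, pow_add]

end Hessenberg

theorem tmk_natCast (q : ℂ) (hq : q⁻¹ ≠ 0) (t : ℤ → RatFunc ℂ) (m : ℕ) (k : ℤ) :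
    tmk q t m k = (hessMatrix (qshiftHom q⁻¹ hq) t k m 0).det := by
  rw [tmk, if_neg (by omega)]
  split_ifs with h
  · obtain rfl : m = 0 := by exact_mod_cast h
    simp [hessMatrix, colIndex]
  · rw [tdet, Int.toNat_natCast]
    congr 1
    ext i j
    simp only [hessMatrix, Matrix.of_apply, qshiftHom_pow_apply, zero_add, colIndex]
    split_ifs
    · rw [add_sub_right_comm]
    · rfl

theorem tmk_of_neg (q : ℂ) (t : ℤ → RatFunc ℂ) {m : ℤ} (hm : m < 0) (k : ℕ) :
    tmk q t m (k + 1) = if (k : ℤ) + 1 + m = 0 then (-1) ^ k else 0 := by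
  simp [tmk, hm]

/-- The recursion for `t^{(m)}_{k+1}` obtained by expanding along the first row. -/
theorem tmk_recursion (q : ℂ) (hq : q⁻¹ ≠ 0) (n : ℕ) (t : ℤ → RatFunc ℂ) (ht0 : t 0 = 1)
    (ht : ∀ i < 0, t i = 0) (htn : ∀ i > (n : ℤ), t i = 0) (m k : ℕ) :
    ∑ l ∈ Finset.range n, (-1) ^ l * t (l + 1) *
        (qshiftHom q⁻¹ hq ^ (l + 1)) (tmk q t ((m : ℤ) - 1 - l) (k + 1)) =
      tmk q t m (k + 1) := by
  set σ := qshiftHom q⁻¹ hq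
  set f : ℕ → RatFunc ℂ := fun l => (-1) ^ l * t (l + 1) *
    (σ ^ (l + 1)) (tmk q t ((m : ℤ) - 1 - l) (k + 1)) with hf
  have hbig : ∑ l ∈ Finset.range n, f l = ∑ l ∈ Finset.range (m + (n + k + 1)), f l := by
    refine Finset.sum_subset (Finset.range_mono (by omega)) fun l _ hl => ?_
    rw [Finset.mem_range, not_lt] at hl
    simp [hf, htn (l + 1) (by omega)]
  have htail : ∑ i ∈ Finset.range (n + k + 1), f (m + i) = f (m + k) := by
    refine Finset.sum_eq_single k (fun i _ hi => ?_) fun h =>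
      absurd (Finset.mem_range.2 (by omega)) h
    simp only [hf]
    rw [tmk_of_neg q t (by push_cast; omega), if_neg (by push_cast; omega), map_zero, mul_zero]
  have hlast : f (m + k) = (-1) ^ m * t (k + 1 + m) := by
    simp only [hf]
    rw [tmk_of_neg q t (by push_cast; omega), if_pos (by push_cast; ring), map_pow, map_neg,
      map_one, pow_add, show ((m + k : ℕ) : ℤ) + 1 = k + 1 + m by push_cast; ring]
    have hsq : (-1 : RatFunc ℂ) ^ k * (-1) ^ k = 1 := by simp [← mul_pow]
    linear_combination (-1) ^ m * t (k + 1 + m) * hsq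
  rw [hbig, Finset.sum_range_add, htail, hlast, tmk_natCast q hq, det_hessMatrix _ _ _ ht0 ht]
  congr 1
  refine Finset.sum_congr rfl fun l hl => ?_
  have hl := Finset.mem_range.1 hl
  simp only [hf]
  rw [show (m : ℤ) - 1 - l = ((m - 1 - l : ℕ) : ℤ) by omega, tmk_natCast q hq,
    pow_apply_det_hessMatrix]

/-- The product `A(x) A(q^{-1} x) ⋯ A(q^{1-m} x)` of `m` factors, where
 `σ f (x) = f (q^{-1} x)`. -/
def companionProd (σ : RatFunc ℂ →+* RatFunc ℂ) (n : ℕ) (t : ℤ → RatFunc ℂ) (m : ℕ) :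
    Matrix (Fin n) (Fin n) (RatFunc ℂ) :=
  ((List.range m).map fun j => (σ ^ j).mapMatrix (companion n t)).prod

theorem companionProd_zero (σ : RatFunc ℂ →+* RatFunc ℂ) (n : ℕ) (t : ℤ → RatFunc ℂ) :
    companionProd σ n t 0 = 1 := rfl

theorem companionProd_succ (σ : RatFunc ℂ →+* RatFunc ℂ) (n : ℕ) (t : ℤ → RatFunc ℂ) (m : ℕ) :
    companionProd σ n t (m + 1) = companion n t * σ.mapMatrix (companionProd σ n t m) := by
  rw [companionProd, companionProd, List.range_succ_eq_map, List.map_cons, List.prod_cons,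
    map_list_prod, List.map_map, List.map_map]
  refine congrArg₂ (· * ·) rfl (congrArg List.prod (List.map_congr_left fun i _ => ?_))
  ext a b
  simp only [Function.comp_apply, RingHom.mapMatrix_apply, Matrix.map_apply, Nat.succ_eq_add_one,
    pow_succ', RingHom.mul_def, RingHom.comp_apply]

theorem Aprod_eq_companionProd (q : ℂ) (hq : q⁻¹ ≠ 0) (n : ℕ) (t : ℤ → RatFunc ℂ) (m : ℕ) :
    Aprod q n t m = companionProd (qshiftHom q⁻¹ hq) n t (m + 1) := by
  have hfun : ∀ i : ℕ, ⇑(qshiftHom q⁻¹ hq ^ i) = qshift (q ^ (-(i : ℤ))) :=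
    fun i => funext (qshiftHom_pow_apply q hq i)
  simp only [Aprod, companionProd, RingHom.mapMatrix_apply, hfun, List.pure_def,
    List.bind_eq_flatMap, ← List.map_eq_flatMap, List.map_map, Function.comp_def]

/-- Entries of `A(x) A(q^{-1} x) ⋯ A(q^{1-m} x)`, including the empty product `m = 0`. -/
theorem prod_companion_entries (q : ℂ) (hq : q⁻¹ ≠ 0) (n : ℕ) (t : ℤ → RatFunc ℂ)
    (ht0 : t 0 = 1) (ht : ∀ i < 0, t i = 0) (htn : ∀ i > (n : ℤ), t i = 0) (m : ℕ) :
    ∀ j k : Fin n,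
      companionProd (qshiftHom q⁻¹ hq) n t m j k =
        (-1) ^ (k : ℕ) * (qshiftHom q⁻¹ hq ^ (j : ℕ))
          (tmk q t ((m : ℤ) - 1 - ((j : ℕ) : ℤ)) (((k : ℕ) : ℤ) + 1)) := by
  set σ := qshiftHom q⁻¹ hq
  induction m with
  | zero =>
    intro j k
    rw [tmk_of_neg q t (by push_cast; omega)]
    rw [companionProd_zero, Matrix.one_apply]
    by_cases h : j = k
    · subst h
      rw [if_pos rfl, if_pos (by push_cast; ring), map_pow, map_neg, map_one,
        ← mul_pow, neg_one_mul, neg_neg, one_pow]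
    · rw [if_neg h, if_neg (by rw [Fin.ext_iff] at h; push_cast; omega), map_zero, mul_zero]
  | succ m ih =>
    intro j k
    rw [companionProd_succ, Matrix.mul_apply]
    simp only [RingHom.mapMatrix_apply, Matrix.map_apply, ih, companion, Matrix.of_apply]
    have hσ : ∀ (i : ℕ) (x : RatFunc ℂ),
        σ ((-1) ^ (k : ℕ) * (σ ^ i) x) = (-1) ^ (k : ℕ) * (σ ^ (i + 1)) x := by
      intro i x
      simp [pow_succ']
    simp only [hσ]
    obtain ⟨_ | j, hj⟩ := j
    · simp only [if_true]
      rw [show ((m + 1 : ℕ) : ℤ) - 1 - ((0 : ℕ) : ℤ) = m by push_cast; ring, pow_zero,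
        RingHom.one_def, RingHom.id_apply, ← tmk_recursion q hq n t ht0 ht htn m k,
        Finset.mul_sum, ← Fin.sum_univ_eq_sum_range (fun l => (-1) ^ (k : ℕ) *
          ((-1) ^ l * t (l + 1) *
            (σ ^ (l + 1)) (tmk q t ((m : ℤ) - 1 - l) ((k : ℕ) + 1))))]
      exact Finset.sum_congr rfl fun l _ => by ring
    · rw [Finset.sum_eq_single ⟨j, by omega⟩]
      · simp only [Nat.add_eq_zero_iff, one_ne_zero, and_false, if_false, if_true, one_mul]
        congr 3
        push_cast
        ring
      · intro l _ hl
        rw [if_neg (by simp), if_neg (fun h => hl (Fin.ext (by simp at h ⊢; omega))), zero_mul]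
      · simp

/-- the `(j,k)` entry (1-based) of `A^{(m)}(x)` equals
`(-1)^{k-1} t^{(m+1-j)}_k (q^{1-j} x)`; here indices are 0-based. -/
theorem Aprod_entries (q : ℂ) (hq0 : q ≠ 0) (hq1 : ‖q‖ < 1)
    (n : ℕ) (a : ℕ → Polynomial ℂ) (ha : a 0 ≠ 0) :
    ∀ m : ℕ, ∀ j k : Fin n,
      Aprod q n (tcoef n a) m j k
        = (-1 : RatFunc ℂ) ^ (k : ℕ) *
            qshift (q ^ (-((j : ℕ) : ℤ)))
              (tmk q (tcoef n a) ((m : ℤ) - ((j : ℕ) : ℤ)) (((k : ℕ) : ℤ) + 1)) := by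
  intro m j k
  have hq : q⁻¹ ≠ 0 := inv_ne_zero hq0
  have ha' : algebraMap (Polynomial ℂ) (RatFunc ℂ) (a 0) ≠ 0 := RatFunc.algebraMap_ne_zero ha
  have h := prod_companion_entries q hq n (tcoef n a) (by simp [tcoef, ha'])
    (fun i hi => if_neg (by omega)) (fun i hi => if_neg (by omega)) (m + 1) j k
  rw [Aprod_eq_companionProd q hq, h, qshiftHom_pow_apply]
  congr 3
  push_cast
  ring

end
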